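/- arXiv:2112.08897 — 2 statements merged into one kernel-verified Lean document; each statement's English description precedes it below -/
import Mathlib

section
/- Let k be an algebraically closed field, G̃ a finite group and G a normal subgroup of G̃ such that H²(G̃/G, k^×) is trivial and the group algebra k[G̃/G] is basic. Let V be an indecomposable G̃-stable finitely generated kG-module and let ι : V → I be an injective envelope with cokernel C = Ω^{-1}(V). Then Ind_G^{G̃} ι : Ind_G^{G̃} V → Ind_G^{G̃} I is an injective envelope of the kG̃-module Ind_G^{G̃} V with cokernel isomorphic to Ind_G^{G̃} C; in particular I(Ind_G^{G̃} V) ≅ Ind_G^{G̃} I(V) and Ω^{-1}(Ind_G^{G̃} V) ≅ Ind_G^{G̃} Ω^{-1}(V). -/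
open scoped TensorProduct

namespace Paper

/-! ### Torsion-theoretic notions over an arbitrary ring -/

section Torsion

variable (R : Type) [Ring R]

/-- `FacCl R C` : quotient modules of finite direct sums of modules in `C`. -/
def FacCl (C : ModuleCat.{0} R → Prop) (M : ModuleCat.{0} R) : Prop :=
  ∃ (n : ℕ) (N : Fin n → ModuleCat.{0} R), (∀ i, C (N i)) ∧
    ∃ f : ((i : Fin n) → N i) →ₗ[R] M, Function.Surjective f

/-- `SubCl R C` : submodules of finite direct sums of modules in `C`. -/
def SubCl (C : ModuleCat.{0} R → Prop) (M : ModuleCat.{0} R) : Prop :=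
  ∃ (n : ℕ) (N : Fin n → ModuleCat.{0} R), (∀ i, C (N i)) ∧
    ∃ f : M →ₗ[R] ((i : Fin n) → N i), Function.Injective f

/-- `AddCl R C` : direct summands of finite direct sums of modules in `C`. -/
def AddCl (C : ModuleCat.{0} R → Prop) (M : ModuleCat.{0} R) : Prop :=
  ∃ (n : ℕ) (N : Fin n → ModuleCat.{0} R), (∀ i, C (N i)) ∧
    ∃ (s : M →ₗ[R] ((i : Fin n) → N i)) (r : ((i : Fin n) → N i) →ₗ[R] M),
      ∀ m : M, r (s m) = m

/-- `FiltCl R C` : modules having a finite filtration with subquotients in `add C`. -/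
def FiltCl (C : ModuleCat.{0} R → Prop) (M : ModuleCat.{0} R) : Prop :=
  ∃ (l : ℕ) (F : Fin (l + 1) → Submodule R M),
    Monotone F ∧ F 0 = ⊥ ∧ F (Fin.last l) = ⊤ ∧
      ∀ i : Fin l, AddCl R C (ModuleCat.of R
        (↥(F i.succ) ⧸ Submodule.comap (F i.succ).subtype (F i.castSucc)))

/-- A torsion class inside the ambient class `Amb` of modules:  a subclass of `Amb`
closed under quotient modules, finite direct sums and extensions. -/
def IsTorsionClassIn (Amb T : ModuleCat.{0} R → Prop) : Prop :=
  (∀ M, T M → Amb M) ∧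
  (∀ (M N : ModuleCat.{0} R) (f : M →ₗ[R] N),
      Amb N → Function.Surjective f → T M → T N) ∧
  (∀ (n : ℕ) (N : Fin n → ModuleCat.{0} R), (∀ i, T (N i)) →
      Amb (ModuleCat.of R ((i : Fin n) → N i)) →
      T (ModuleCat.of R ((i : Fin n) → N i))) ∧
  (∀ (M : ModuleCat.{0} R) (A : Submodule R M), Amb M →
      T (ModuleCat.of R ↥A) → T (ModuleCat.of R (↥M ⧸ A)) → T M)

/-- A torsion-free class inside the ambient class `Amb` of modules. -/
def IsTorsionFreeClassIn (Amb F : ModuleCat.{0} R → Prop) : Prop :=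
  (∀ M, F M → Amb M) ∧
  (∀ (M N : ModuleCat.{0} R) (f : M →ₗ[R] N),
      Amb M → Function.Injective f → F N → F M) ∧
  (∀ (n : ℕ) (N : Fin n → ModuleCat.{0} R), (∀ i, F (N i)) →
      Amb (ModuleCat.of R ((i : Fin n) → N i)) →
      F (ModuleCat.of R ((i : Fin n) → N i))) ∧
  (∀ (M : ModuleCat.{0} R) (A : Submodule R M), Amb M →
      F (ModuleCat.of R ↥A) → F (ModuleCat.of R (↥M ⧸ A)) → F M)

/-- The smallest torsion class (inside `Amb`) containing the class `C`. -/
def TorsClIn (Amb C : ModuleCat.{0} R → Prop) (M : ModuleCat.{0} R) : Prop :=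
  ∀ T : ModuleCat.{0} R → Prop, IsTorsionClassIn R Amb T →
    (∀ X, Amb X → C X → T X) → T M

/-- The smallest torsion-free class (inside `Amb`) containing the class `C`. -/
def TorfClIn (Amb C : ModuleCat.{0} R → Prop) (M : ModuleCat.{0} R) : Prop :=
  ∀ F : ModuleCat.{0} R → Prop, IsTorsionFreeClassIn R Amb F →
    (∀ X, Amb X → C X → F X) → F M

/-- The ambient class of finitely generated modules. -/
def FGMod (M : ModuleCat.{0} R) : Prop := Module.Finite R M

def ContravariantlyFinite (Amb C : ModuleCat.{0} R → Prop) : Prop :=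
  ∀ M : ModuleCat.{0} R, Amb M →
    ∃ X : ModuleCat.{0} R, C X ∧ ∃ f : X →ₗ[R] M,
      ∀ Y : ModuleCat.{0} R, C Y → ∀ g : Y →ₗ[R] M,
        ∃ h : Y →ₗ[R] X, ∀ y : Y, f (h y) = g y

def CovariantlyFinite (Amb C : ModuleCat.{0} R → Prop) : Prop :=
  ∀ M : ModuleCat.{0} R, Amb M →
    ∃ X : ModuleCat.{0} R, C X ∧ ∃ f : M →ₗ[R] X,
      ∀ Y : ModuleCat.{0} R, C Y → ∀ g : M →ₗ[R] Y,
        ∃ h : X →ₗ[R] Y, ∀ m : M, h (f m) = g m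

def FunctoriallyFinite (Amb C : ModuleCat.{0} R → Prop) : Prop :=
  ContravariantlyFinite R Amb C ∧ CovariantlyFinite R Amb C

/-- `M` is (isomorphic to) a direct summand of `W`. -/
def IsSummandOf (X W : Type) [AddCommGroup X] [Module R X]
    [AddCommGroup W] [Module R W] : Prop :=
  ∃ (s : X →ₗ[R] W) (r : W →ₗ[R] X), ∀ x : X, r (s x) = x

/-- An indecomposable module: nonzero and not the direct sum of two nonzero submodules. -/
def IndecMod (M : Type) [AddCommGroup M] [Module R M] : Prop :=
  Nontrivial M ∧ ∀ A B : Submodule R M, IsCompl A B → A = ⊥ ∨ B = ⊥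

/-- A projective cover: a surjection from a projective module with superfluous kernel. -/
def IsProjCover {P V : Type} [AddCommGroup P] [Module R P]
    [AddCommGroup V] [Module R V] (π : P →ₗ[R] V) : Prop :=
  Module.Projective R P ∧ Function.Surjective π ∧
    ∀ L : Submodule R P, LinearMap.ker π ⊔ L = ⊤ → L = ⊤

/-- An injective envelope: an injection into an injective module with essential image. -/
def IsInjEnv {V I : Type} [AddCommGroup V] [Module R V]
    [AddCommGroup I] [Module R I] (ι : V →ₗ[R] I) : Prop :=
  Module.Injective R I ∧ Function.Injective ι ∧
    ∀ L : Submodule R I, L ≠ ⊥ → L ⊓ LinearMap.range ι ≠ ⊥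

/-- A central idempotent. -/
def IsCentralIdem (b : R) : Prop :=
  b * b = b ∧ ∀ a : R, a * b = b * a

/-- A block idempotent: a primitive idempotent of the center. -/
def IsBlockIdem (b : R) : Prop :=
  b ≠ 0 ∧ IsCentralIdem R b ∧
    ∀ c d : R, IsCentralIdem R c → IsCentralIdem R d →
      c * d = 0 → d * c = 0 → b = c + d → c = 0 ∨ d = 0

/-- The module `U` lies in the block determined by the central idempotent `b`. -/
def LiesIn (b : R) (U : Type) [AddCommGroup U] [Module R U] : Prop :=
  ∀ u : U, b • u = u

/-- The `b`-component `b·M` of a module `M`, for a central idempotent `b`. -/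
def blockComp (b : R) (hb : ∀ a : R, a * b = b * a)
    (M : Type) [AddCommGroup M] [Module R M] : Submodule R M where
  carrier := {m : M | b • m = m}
  add_mem' := by
    intro x y hx hy
    simp only [Set.mem_setOf_eq] at *
    rw [smul_add, hx, hy]
  zero_mem' := by simp
  smul_mem' := by
    intro c m hm
    simp only [Set.mem_setOf_eq] at *
    rw [smul_smul, ← hb c, mul_smul, hm]

/-- The ambient class of finitely generated modules lying in the block of `b`. -/
def BlockFG (b : R) : ModuleCat.{0} R → Prop :=
  fun M => Module.Finite R M ∧ LiesIn R b M

end Torsion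

/-! ### Bundled modules with a compatible `k`-structure -/

structure BModule (k R : Type) [CommSemiring k] [Ring R] [Algebra k R] : Type 1 where
  carrier : Type
  [isAddCommGroup : AddCommGroup carrier]
  [isModuleK : Module k carrier]
  [isModuleR : Module R carrier]
  [isTower : IsScalarTower k R carrier]

attribute [instance] BModule.isAddCommGroup BModule.isModuleK BModule.isModuleR
  BModule.isTower

instance (k R : Type) [CommSemiring k] [Ring R] [Algebra k R] :
    CoeSort (BModule k R) Type :=
  ⟨BModule.carrier⟩

section GroupAlg

variable (k : Type) [Field k]

/-- A brick over a `k`-algebra `R`: a nonzero module all of whose `R`-endomorphisms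
are given by scalars in `k`. -/
def IsBrickOver (R : Type) [Ring R] [Algebra k R]
    (U : Type) [AddCommGroup U] [Module R U] : Prop :=
  Nontrivial U ∧ ∀ f : U →ₗ[R] U, ∃ c : k, ∀ u : U, f u = algebraMap k R c • u

/-- A module which is a finite direct sum of bricks with no nonzero homomorphisms
between non-isomorphic summands. -/
def IsSemibrickModule (R : Type) [Ring R] [Algebra k R]
    (M : Type) [AddCommGroup M] [Module R M] : Prop :=
  ∃ (m : ℕ) (T : Fin m → BModule k R),
    Nonempty (M ≃ₗ[R] ((i : Fin m) → ↥(T i))) ∧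
    (∀ i, IsBrickOver k R ↥(T i)) ∧
    ∀ i j, IsEmpty (↥(T i) ≃ₗ[R] ↥(T j)) → ∀ f : ↥(T i) →ₗ[R] ↥(T j), f = 0

/-- `V` is one-dimensional over `k`. -/
def OneDimOver (V : Type) [AddCommGroup V] [Module k V] : Prop :=
  ∃ v : V, v ≠ 0 ∧ ∀ w : V, ∃ c : k, w = c • v

/-- Triviality of the second group cohomology `H²(Q, kˣ)` (trivial action):
every `2`-cocycle is a `2`-coboundary. -/
def H2Trivial (Q : Type) [Group Q] : Prop :=
  ∀ α : Q → Q → kˣ,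
    (∀ a b c : Q, α a b * α (a * b) c = α b c * α a (b * c)) →
    ∃ β : Q → kˣ, ∀ a b : Q, α a b = β a * β b * (β (a * b))⁻¹

/-- The `k`-algebra `R` is basic (for `k` algebraically closed this means that
every simple module is one-dimensional over `k`). -/
def BasicAlg (R : Type) [Ring R] [Algebra k R] : Prop :=
  ∀ V : BModule k R, IsSimpleModule R ↥V → OneDimOver k ↥V

/-- `P` has exactly `n` isomorphism classes of modules satisfying it. -/
def RepClasses (R : Type) [Ring R] [Algebra k R]
    (P : BModule k R → Prop) (n : ℕ) : Prop :=
  ∃ V : Fin n → BModule k R, (∀ i, P (V i)) ∧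
    (∀ i j, i ≠ j → IsEmpty (↥(V i) ≃ₗ[R] ↥(V j))) ∧
    ∀ W : BModule k R, P W → ∃ i, Nonempty (↥W ≃ₗ[R] ↥(V i))

/-- The ring homomorphism `k[A] → k[B]` induced by a group homomorphism `f : A → B`. -/
noncomputable def MapAlong {A B : Type} [Group A] [Group B] (f : A →* B) :
    MonoidAlgebra k A →+* MonoidAlgebra k B :=
  MonoidAlgebra.mapDomainRingHom k f

/-- The `k[B]`-module `W` restricted along `f : A → B` is isomorphic to the
`k[A]`-module `U`; i.e. `W` is an extending module of `U`. -/
def ExtendsAlong {A B : Type} [Group A] [Group B] (f : A →* B)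
    (U : Type) [AddCommGroup U] [Module (MonoidAlgebra k A) U]
    (W : Type) [AddCommGroup W] [Module (MonoidAlgebra k B) W] : Prop :=
  ∃ φ : U ≃+ W, ∀ (a : MonoidAlgebra k A) (u : U),
    φ (a • u) = MapAlong k f a • φ u

/-- `η : U →+ W` exhibits the `k[B]`-module `W` as the module induced along
`f : A → B` from the `k[A]`-module `U`: `η` is `k[A]`-linear into the restriction
of `W`, and has the universal (left-adjoint) property. -/
def IsInducedUnit {A B : Type} [Group A] [Group B] (f : A →* B)
    (U : Type) [AddCommGroup U] [Module (MonoidAlgebra k A) U]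
    (W : Type) [AddCommGroup W] [Module (MonoidAlgebra k B) W]
    (η : U →+ W) : Prop :=
  (∀ (a : MonoidAlgebra k A) (u : U), η (a • u) = MapAlong k f a • η u) ∧
  ∀ (X : BModule k (MonoidAlgebra k B)) (g : U →+ ↥X),
    (∀ (a : MonoidAlgebra k A) (u : U), g (a • u) = MapAlong k f a • g u) →
    ∃! F : W →ₗ[MonoidAlgebra k B] ↥X, ∀ u : U, F (η u) = g u

/-- `W` is (a realization of) the induced module `Ind` of `U` along `f`. -/
def IsInducedAlong {A B : Type} [Group A] [Group B] (f : A →* B)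
    (U : Type) [AddCommGroup U] [Module (MonoidAlgebra k A) U]
    (W : Type) [AddCommGroup W] [Module (MonoidAlgebra k B) W] : Prop :=
  ∃ η : U →+ W, IsInducedUnit k f U W η

variable (Gt : Type) [Group Gt] (G : Subgroup Gt) [G.Normal]

/-- Conjugation `g ↦ x⁻¹ g x` as a homomorphism of the normal subgroup `G`. -/
def conjHom (x : Gt) : ↥G →* ↥G where
  toFun g := ⟨x⁻¹ * ↑g * x, ‹G.Normal›.conj_mem' (↑g) g.2 x⟩
  map_one' := by
    apply Subtype.ext
    simp
  map_mul' g h := by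
    apply Subtype.ext
    push_cast
    group

/-- The `kG`-module `U` is stable under conjugation by `x`, i.e. `ˣU ≅ U`. -/
def IsStableAt (x : Gt) (U : Type) [AddCommGroup U]
    [Module (MonoidAlgebra k ↥G) U] : Prop :=
  ∃ ψ : U ≃+ U, ∀ (a : MonoidAlgebra k ↥G) (u : U),
    ψ (MapAlong k (conjHom Gt G x) a • u) = a • ψ u

/-- The `kG`-module `U` is `G̃`-stable. -/
def IsGtStable (U : Type) [AddCommGroup U]
    [Module (MonoidAlgebra k ↥G) U] : Prop :=
  ∀ x : Gt, IsStableAt k Gt G x U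

/-- The inertia group of an element `b ∈ kG` inside `G̃`:
all `x ∈ G̃` with `x b x⁻¹ = b`. -/
def inertia (b : MonoidAlgebra k ↥G) : Subgroup Gt where
  carrier := {x : Gt | Commute (MonoidAlgebra.of k Gt x) (MapAlong k G.subtype b)}
  one_mem' := by
    simp only [Set.mem_setOf_eq, map_one]
    exact Commute.one_left _
  mul_mem' := by
    intro a c ha hc
    simp only [Set.mem_setOf_eq, map_mul] at *
    exact ha.mul_left hc
  inv_mem' := by
    intro a ha
    simp only [Set.mem_setOf_eq] at *
    have h1 : MonoidAlgebra.of k Gt a⁻¹ * MonoidAlgebra.of k Gt a = 1 := by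
      rw [← map_mul, inv_mul_cancel, map_one]
    have h2 : MonoidAlgebra.of k Gt a * MonoidAlgebra.of k Gt a⁻¹ = 1 := by
      rw [← map_mul, mul_inv_cancel, map_one]
    show MonoidAlgebra.of k Gt a⁻¹ * MapAlong k G.subtype b
        = MapAlong k G.subtype b * MonoidAlgebra.of k Gt a⁻¹
    calc MonoidAlgebra.of k Gt a⁻¹ * MapAlong k G.subtype b
        = MonoidAlgebra.of k Gt a⁻¹ * MapAlong k G.subtype b *
            (MonoidAlgebra.of k Gt a * MonoidAlgebra.of k Gt a⁻¹) := by
          rw [h2, mul_one]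
      _ = MonoidAlgebra.of k Gt a⁻¹ * (MapAlong k G.subtype b * MonoidAlgebra.of k Gt a) *
            MonoidAlgebra.of k Gt a⁻¹ := by noncomm_ring
      _ = MonoidAlgebra.of k Gt a⁻¹ * (MonoidAlgebra.of k Gt a * MapAlong k G.subtype b) *
            MonoidAlgebra.of k Gt a⁻¹ := by rw [← ha.eq]
      _ = (MonoidAlgebra.of k Gt a⁻¹ * MonoidAlgebra.of k Gt a) *
            (MapAlong k G.subtype b * MonoidAlgebra.of k Gt a⁻¹) := by noncomm_ring
      _ = MapAlong k G.subtype b * MonoidAlgebra.of k Gt a⁻¹ := by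
          rw [h1, one_mul]

/-- Relative projectivity of a `k[A]`-module with respect to a subgroup `D ≤ A`:
any `k[A]`-linear surjection onto a quotient admitting a `k[D]`-linear splitting of
a lifting problem admits a `k[A]`-linear solution. -/
def RelProj (A : Type) [Group A] (D : Subgroup A)
    (U : Type) [AddCommGroup U] [Module (MonoidAlgebra k A) U] : Prop :=
  ∀ (M N : BModule k (MonoidAlgebra k A))
    (f : ↥M →ₗ[MonoidAlgebra k A] ↥N) (g : U →ₗ[MonoidAlgebra k A] ↥N),
    Function.Surjective f →
    (∃ h : U →+ ↥M,
        (∀ (c : k) (u : U),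
          h (algebraMap k (MonoidAlgebra k A) c • u)
            = algebraMap k (MonoidAlgebra k A) c • h u) ∧
        (∀ (d : ↥D) (u : U),
          h (MonoidAlgebra.of k A ↑d • u) = MonoidAlgebra.of k A ↑d • h u) ∧
        ∀ u : U, f (h u) = g u) →
    ∃ h' : U →ₗ[MonoidAlgebra k A] ↥M, ∀ u : U, f (h' u) = g u

/-- `D` is a defect group of the block of `b`: `D` is minimal with respect to
inclusion among subgroups such that every module in the block is relatively
`D`-projective. -/
def IsDefectGroup (A : Type) [Group A] (b : MonoidAlgebra k A)
    (D : Subgroup A) : Prop :=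
  (∀ U : BModule k (MonoidAlgebra k A),
      LiesIn (MonoidAlgebra k A) b ↥U → RelProj k A D ↥U) ∧
  ∀ D' : Subgroup A, D' ≤ D →
    (∀ U : BModule k (MonoidAlgebra k A),
        LiesIn (MonoidAlgebra k A) b ↥U → RelProj k A D' ↥U) →
    D' = D

/-- Left finiteness (inside the ambient class `Amb`) of a module `S`: the smallest
torsion class containing `S` is functorially finite. -/
def IsLeftFiniteIn (R : Type) [Ring R] (Amb : ModuleCat.{0} R → Prop)
    (S : Type) [AddCommGroup S] [Module R S] : Prop :=
  FunctoriallyFinite R Amb (TorsClIn R Amb (fun X => Nonempty (↥X ≃ₗ[R] S)))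

/-- `W₂` realizes the tensor product `W₁ ⊗ₖ V` with the diagonal `G̃`-action, where
`V` is a `k[G̃/G]`-module viewed as a `k[G̃]`-module via the projection. -/
def DiagTensorIso
    (W₁ : Type) [AddCommGroup W₁] [Module k W₁] [Module (MonoidAlgebra k Gt) W₁]
    [IsScalarTower k (MonoidAlgebra k Gt) W₁]
    (V : Type) [AddCommGroup V] [Module k V] [Module (MonoidAlgebra k (Gt ⧸ G)) V]
    [IsScalarTower k (MonoidAlgebra k (Gt ⧸ G)) V]
    (W₂ : Type) [AddCommGroup W₂] [Module k W₂] [Module (MonoidAlgebra k Gt) W₂]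
    [IsScalarTower k (MonoidAlgebra k Gt) W₂] : Prop :=
  ∃ θ : (W₁ ⊗[k] V) ≃ₗ[k] W₂,
    ∀ (x : Gt) (w : W₁) (v : V),
      θ ((MonoidAlgebra.of k Gt x • w) ⊗ₜ[k]
          (MonoidAlgebra.of k (Gt ⧸ G) (QuotientGroup.mk x) • v))
        = MonoidAlgebra.of k Gt x • θ (w ⊗ₜ[k] v)

end GroupAlg


section Induction

variable {k : Type} [Field k] {Gt : Type} [Group Gt] {G : Subgroup Gt}

/-- The projection `k[G̃] → k[G]` forgetting the coefficients outside `G`. -/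
noncomputable def restrictCoeff (k : Type) [Field k] {Gt : Type} [Group Gt] (G : Subgroup Gt) :
    MonoidAlgebra k Gt →+ MonoidAlgebra k ↥G :=
  MonoidAlgebra.comapDomainAddMonoidHom G.subtype G.subtype_injective

lemma restrictCoeff_single_coe (g : ↥G) (r : k) :
    restrictCoeff k G (MonoidAlgebra.single (g : Gt) r) = MonoidAlgebra.single g r :=
  MonoidAlgebra.comapDomain_single_map G.subtype G.subtype_injective g r

lemma restrictCoeff_single_of_notMem {x : Gt} (hx : x ∉ G) (r : k) :
    restrictCoeff k G (MonoidAlgebra.single x r) = 0 :=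
  MonoidAlgebra.comapDomain_single_of_not_mem_range (by simpa using hx) G.subtype_injective

@[simp]
lemma mapAlong_single {A B : Type} [Group A] [Group B] (f : A →* B) (a : A) (r : k) :
    MapAlong k f (MonoidAlgebra.single a r) = MonoidAlgebra.single (f a) r := by
  simp [MapAlong]

lemma restrictCoeff_mapAlong_mul (a : MonoidAlgebra k ↥G) (s : MonoidAlgebra k Gt) :
    restrictCoeff k G (MapAlong k G.subtype a * s) = a * restrictCoeff k G s := by
  induction a using MonoidAlgebra.induction_linear with
  | zero => simp
  | add a b ha hb => simp only [map_add, add_mul, ha, hb]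
  | single g r =>
    induction s using MonoidAlgebra.induction_linear with
    | zero => simp
    | add s t hs ht => simp only [map_add, mul_add, hs, ht]
    | single x c =>
      rw [mapAlong_single, MonoidAlgebra.single_mul_single]
      by_cases hx : x ∈ G
      · lift x to ↥G using hx
        rw [restrictCoeff_single_coe, G.subtype_apply, ← G.coe_mul, restrictCoeff_single_coe,
          MonoidAlgebra.single_mul_single]
      · rw [restrictCoeff_single_of_notMem hx, restrictCoeff_single_of_notMem, mul_zero]
        exact fun h => hx ((G.mul_mem_cancel_left g.2).1 h)

lemma restrictCoeff_mul_mapAlong (s : MonoidAlgebra k Gt) (a : MonoidAlgebra k ↥G) :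
    restrictCoeff k G (s * MapAlong k G.subtype a) = restrictCoeff k G s * a := by
  induction a using MonoidAlgebra.induction_linear with
  | zero => simp
  | add a b ha hb => simp only [map_add, mul_add, ha, hb]
  | single g r =>
    induction s using MonoidAlgebra.induction_linear with
    | zero => simp
    | add s t hs ht => simp only [map_add, add_mul, hs, ht]
    | single x c =>
      rw [mapAlong_single, MonoidAlgebra.single_mul_single]
      by_cases hx : x ∈ G
      · lift x to ↥G using hx
        rw [restrictCoeff_single_coe, G.subtype_apply, ← G.coe_mul, restrictCoeff_single_coe,
          MonoidAlgebra.single_mul_single]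
      · rw [restrictCoeff_single_of_notMem hx, restrictCoeff_single_of_notMem, zero_mul]
        exact fun h => hx ((G.mul_mem_cancel_right g.2).1 h)

lemma restrictCoeff_one : restrictCoeff k G 1 = 1 :=
  restrictCoeff_single_coe 1 1

/-- A module over a `k`-algebra with its underlying `k`-module structure. -/
def BModule.ofModule (k R M : Type) [CommSemiring k] [Ring R] [Algebra k R]
    [AddCommGroup M] [Module R M] : BModule k R :=
  letI : Module k M := Module.compHom M (algebraMap k R)
  { carrier := M
    isTower := ⟨fun c r m => by rw [Algebra.smul_def, mul_smul]; rfl⟩ }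

variable {U W N : Type} [AddCommGroup U] [Module (MonoidAlgebra k ↥G) U]
  [AddCommGroup W] [Module (MonoidAlgebra k Gt) W]
  [AddCommGroup N] [Module (MonoidAlgebra k Gt) N] {η : U →+ W}

lemma IsInducedUnit.exists_lift (hη : IsInducedUnit k G.subtype U W η) (g : U →+ N)
    (hg : ∀ (a : MonoidAlgebra k ↥G) (u : U), g (a • u) = MapAlong k G.subtype a • g u) :
    ∃ F : W →ₗ[MonoidAlgebra k Gt] N, ∀ u, F (η u) = g u :=
  (hη.2 (BModule.ofModule k (MonoidAlgebra k Gt) N) g hg).exists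

lemma IsInducedUnit.hom_ext (hη : IsInducedUnit k G.subtype U W η)
    {F F' : W →ₗ[MonoidAlgebra k Gt] N} (h : ∀ u, F (η u) = F' (η u)) : F = F' :=
  (hη.2 (BModule.ofModule k (MonoidAlgebra k Gt) N) ((F' : W →+ N).comp η)
    (fun a u => (congrArg F' (hη.1 a u)).trans (F'.map_smul _ _))).unique h (fun _ => rfl)

variable (k G U) in
/-- The coinduced module: additive maps `φ : k[G̃] → U` with `φ (a s) = a • φ s` for `a ∈ k[G]`. -/
def Coinduced : AddSubgroup (MonoidAlgebra k Gt →+ U) where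
  carrier := {φ | ∀ (a : MonoidAlgebra k ↥G) (s : MonoidAlgebra k Gt),
    φ (MapAlong k G.subtype a * s) = a • φ s}
  add_mem' hφ hψ a s := by
    simp only [AddMonoidHom.add_apply, smul_add]
    rw [hφ, hψ]
  zero_mem' a s := (smul_zero a).symm
  neg_mem' hφ a s := by
    simp only [AddMonoidHom.neg_apply, smul_neg]
    rw [hφ]

/-- `k[G̃]` acts on the coinduced module by `(s • φ) t = φ (t * s)`. -/
noncomputable instance : Module (MonoidAlgebra k Gt) (Coinduced k G U) where
  smul s φ := ⟨φ.1.comp (AddMonoidHom.mulRight s), fun a t => by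
    simp only [AddMonoidHom.comp_apply, AddMonoidHom.mulRight_apply, mul_assoc]
    exact φ.2 a _⟩
  one_smul φ := Subtype.ext <| AddMonoidHom.ext fun t => congrArg φ.1 (mul_one t)
  mul_smul s t φ := Subtype.ext <| AddMonoidHom.ext fun r => congrArg φ.1 (mul_assoc r s t).symm
  smul_zero _ := rfl
  smul_add _ _ _ := rfl
  add_smul s t φ := Subtype.ext <| AddMonoidHom.ext fun r =>
    (congrArg φ.1 (mul_add r s t)).trans (map_add φ.1 _ _)
  zero_smul φ := Subtype.ext <| AddMonoidHom.ext fun r =>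
    (congrArg φ.1 (mul_zero r)).trans (map_zero φ.1)

lemma Coinduced.smul_apply (s t : MonoidAlgebra k Gt) (φ : Coinduced k G U) :
    (s • φ).1 t = φ.1 (t * s) := rfl

variable (k G U) in
/-- The canonical map from a module to its coinduced module. -/
noncomputable def Coinduced.unit : U →+ Coinduced k G U where
  toFun u := ⟨((smulAddHom (MonoidAlgebra k ↥G) U).flip u).comp (restrictCoeff k G), fun a s => by
    simp [restrictCoeff_mapAlong_mul, mul_smul]⟩
  map_zero' := Subtype.ext <| AddMonoidHom.ext fun _ => smul_zero _
  map_add' u v := Subtype.ext <| AddMonoidHom.ext fun _ => smul_add _ u v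

lemma Coinduced.unit_apply (u : U) (s : MonoidAlgebra k Gt) :
    (Coinduced.unit k G U u).1 s = restrictCoeff k G s • u := rfl

/-- The projection of an induced module onto the component of the identity coset. -/
lemma IsInducedUnit.exists_proj (hη : IsInducedUnit k G.subtype U W η) :
    ∃ p : W →+ U, (∀ (a : MonoidAlgebra k ↥G) (w : W), p (MapAlong k G.subtype a • w) = a • p w) ∧
      ∀ (s : MonoidAlgebra k Gt) (u : U), p (s • η u) = restrictCoeff k G s • u := by
  obtain ⟨F, hF⟩ := hη.exists_lift (Coinduced.unit k G U) (fun a u => by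
    refine Subtype.ext <| AddMonoidHom.ext fun s => ?_
    rw [Coinduced.smul_apply, Coinduced.unit_apply, Coinduced.unit_apply,
      restrictCoeff_mul_mapAlong, mul_smul])
  refine ⟨⟨⟨fun w => (F w).1 1, by simp⟩, fun v w => by simp⟩, fun a w => ?_, fun s u => ?_⟩
  · change (F (MapAlong k G.subtype a • w)).1 1 = a • (F w).1 1
    rw [map_smul, Coinduced.smul_apply, one_mul, ← (F w).2 a 1, mul_one]
  · change (F (s • η u)).1 1 = _
    rw [map_smul, Coinduced.smul_apply, one_mul, hF, Coinduced.unit_apply]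

lemma mapAlong_mul_of (x : Gt) (a : MonoidAlgebra k ↥G) [G.Normal] :
    MapAlong k G.subtype a * MonoidAlgebra.of k Gt x =
      MonoidAlgebra.of k Gt x * MapAlong k G.subtype (MapAlong k (conjHom Gt G x) a) := by
  induction a using MonoidAlgebra.induction_linear with
  | zero => simp
  | add a b ha hb => simp only [map_add, add_mul, mul_add, ha, hb]
  | single g r => simp [conjHom, MonoidAlgebra.of_apply, mul_assoc]

lemma of_inv_mul_mapAlong (x : Gt) (a : MonoidAlgebra k ↥G) [G.Normal] :
    MonoidAlgebra.of k Gt x⁻¹ * MapAlong k G.subtype a =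
      MapAlong k G.subtype (MapAlong k (conjHom Gt G x) a) * MonoidAlgebra.of k Gt x⁻¹ := by
  have h := congrArg (fun b => MonoidAlgebra.of k Gt x⁻¹ * b * MonoidAlgebra.of k Gt x⁻¹)
    (mapAlong_mul_of x a)
  simpa only [mul_assoc, ← map_mul, mul_inv_cancel, inv_mul_cancel_left, inv_mul_cancel,
    map_one, mul_one, ← mul_assoc (MonoidAlgebra.of k Gt x⁻¹) (MonoidAlgebra.of k Gt x),
    one_mul] using h

/-- An additive map commuting with `k[G]` and with `G̃` is `k[G̃]`-linear. -/
lemma map_smul_of_map_of_smul {M : Type} [AddCommGroup M] [Module (MonoidAlgebra k Gt) M]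
    (h : M →+ N)
    (hG : ∀ (a : MonoidAlgebra k ↥G) (m : M),
      h (MapAlong k G.subtype a • m) = MapAlong k G.subtype a • h m)
    (hGt : ∀ (x : Gt) (m : M),
      h (MonoidAlgebra.of k Gt x • m) = MonoidAlgebra.of k Gt x • h m)
    (s : MonoidAlgebra k Gt) (m : M) : h (s • m) = s • h m := by
  induction s using MonoidAlgebra.induction_linear with
  | zero => simp
  | add s t hs ht => simp only [add_smul, map_add, hs, ht]
  | single x r =>
    have hx : MonoidAlgebra.single x r =
        MapAlong k G.subtype (MonoidAlgebra.single 1 r) * MonoidAlgebra.of k Gt x := by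
      simp [MonoidAlgebra.of_apply]
    rw [hx, mul_smul, hG, hGt, mul_smul]

section Trace

variable {M : Type} [AddCommGroup M] [Module (MonoidAlgebra k Gt) M]

lemma of_smul_map_of_inv_smul_eq (h : M →+ N)
    (hG : ∀ (a : MonoidAlgebra k ↥G) (m : M),
      h (MapAlong k G.subtype a • m) = MapAlong k G.subtype a • h m)
    {x y : Gt} (hxy : (x : Gt ⧸ G) = y) (m : M) :
    MonoidAlgebra.of k Gt x • h (MonoidAlgebra.of k Gt x⁻¹ • m) =
      MonoidAlgebra.of k Gt y • h (MonoidAlgebra.of k Gt y⁻¹ • m) := by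
  have key : ∀ z : Gt, ∀ hz : z ∈ G, ∀ m,
      h (MonoidAlgebra.of k Gt z • m) = MonoidAlgebra.of k Gt z • h m := fun z hz m => by
    have := hG (MonoidAlgebra.of k ↥G ⟨z, hz⟩) m
    simpa [MonoidAlgebra.of_apply] using this
  have h1 : MonoidAlgebra.of k Gt x⁻¹ =
      MonoidAlgebra.of k Gt (x⁻¹ * y) * MonoidAlgebra.of k Gt y⁻¹ := by
    rw [← map_mul, mul_inv_cancel_right]
  rw [h1, mul_smul, key _ (QuotientGroup.eq.1 hxy), smul_smul, ← map_mul, mul_inv_cancel_left]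

/-- The relative trace of a `k[G]`-linear map is `k[G̃]`-linear. -/
lemma exists_relTrace [G.Normal] [Fintype (Gt ⧸ G)] (h : M →+ N)
    (hG : ∀ (a : MonoidAlgebra k ↥G) (m : M),
      h (MapAlong k G.subtype a • m) = MapAlong k G.subtype a • h m) :
    ∃ T : M →ₗ[MonoidAlgebra k Gt] N, ∀ m, T m = ∑ q : Gt ⧸ G,
      MonoidAlgebra.of k Gt q.out • h (MonoidAlgebra.of k Gt q.out⁻¹ • m) := by
  let f : M →+ N := ∑ q : Gt ⧸ G, (DistribSMul.toAddMonoidHom N (MonoidAlgebra.of k Gt q.out)).comp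
    (h.comp (DistribSMul.toAddMonoidHom M (MonoidAlgebra.of k Gt q.out⁻¹)))
  have hf : ∀ m, f m = ∑ q : Gt ⧸ G,
      MonoidAlgebra.of k Gt q.out • h (MonoidAlgebra.of k Gt q.out⁻¹ • m) :=
    fun m => by simp [f]
  have hfs := map_smul_of_map_of_smul (k := k) (G := G) f (fun a m => ?_) (fun x m => ?_)
  · exact ⟨{ f with map_smul' := hfs }, hf⟩
  · rw [hf, hf, Finset.smul_sum]
    refine Finset.sum_congr rfl fun q _ => ?_
    rw [smul_smul _ _ m, of_inv_mul_mapAlong, mul_smul, hG, smul_smul, ← mapAlong_mul_of, mul_smul]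
  · rw [hf, hf, Finset.smul_sum]
    refine (Fintype.sum_equiv (MulAction.toPerm x) _ _ fun q => ?_).symm
    have hq : ((x * q.out : Gt) : Gt ⧸ G) = ((x • q).out : Gt) := by
      rw [QuotientGroup.out_eq']
      exact congrArg (x • ·) (QuotientGroup.out_eq' q)
    rw [MulAction.toPerm_apply, ← of_smul_map_of_inv_smul_eq h hG hq, smul_smul _ _ m, ← map_mul,
      map_mul _ x, mul_smul, mul_inv_rev, inv_mul_cancel_right]

end Trace

section Decomposition

variable [G.Normal] {p : W →+ U}

lemma IsInducedUnit.sum_proj [Fintype (Gt ⧸ G)] (hη : IsInducedUnit k G.subtype U W η)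
    (hp : ∀ (a : MonoidAlgebra k ↥G) (w : W), p (MapAlong k G.subtype a • w) = a • p w)
    (hpη : ∀ (s : MonoidAlgebra k Gt) (u : U), p (s • η u) = restrictCoeff k G s • u) (w : W) :
    ∑ q : Gt ⧸ G, MonoidAlgebra.of k Gt q.out • η (p (MonoidAlgebra.of k Gt q.out⁻¹ • w)) = w := by
  have hG : ∀ (a : MonoidAlgebra k ↥G) (w : W),
      (η.comp p) (MapAlong k G.subtype a • w) = MapAlong k G.subtype a • (η.comp p) w :=
    fun a w => by simp [hp, hη.1]
  obtain ⟨T, hT⟩ := exists_relTrace (η.comp p) hG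
  suffices T = LinearMap.id from (hT w).symm.trans (LinearMap.congr_fun this w)
  refine hη.hom_ext fun u => ?_
  rw [hT, Finset.sum_eq_single 1 (fun q _ hq => ?_) (by simp)]
  · have h1 : (((1 : Gt ⧸ G).out : Gt) : Gt ⧸ G) = (1 : Gt) := QuotientGroup.out_eq' _
    rw [of_smul_map_of_inv_smul_eq (η.comp p) hG h1, inv_one, map_one, one_smul, one_smul,
      AddMonoidHom.comp_apply, ← one_smul (MonoidAlgebra k Gt) (η u), hpη, restrictCoeff_one,
      one_smul]
    simp
  · have hq' : q.out⁻¹ ∉ G := fun h => hq <| by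
      rw [← QuotientGroup.out_eq' q]
      exact (QuotientGroup.eq_one_iff _).2 (G.inv_mem_iff.1 h)
    have h0 : restrictCoeff k G (MonoidAlgebra.of k Gt q.out⁻¹) = 0 :=
      restrictCoeff_single_of_notMem hq' 1
    rw [AddMonoidHom.comp_apply, hpη, h0, zero_smul, map_zero, smul_zero]

lemma IsInducedUnit.eq_of_proj_eq [Finite (Gt ⧸ G)] (hη : IsInducedUnit k G.subtype U W η)
    (hp : ∀ (a : MonoidAlgebra k ↥G) (w : W), p (MapAlong k G.subtype a • w) = a • p w)
    (hpη : ∀ (s : MonoidAlgebra k Gt) (u : U), p (s • η u) = restrictCoeff k G s • u)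
    {v w : W}
    (h : ∀ x : Gt, p (MonoidAlgebra.of k Gt x • v) = p (MonoidAlgebra.of k Gt x • w)) :
    v = w := by
  have := Fintype.ofFinite (Gt ⧸ G)
  rw [← hη.sum_proj hp hpη v, ← hη.sum_proj hp hpη w]
  simp only [h]

end Decomposition

/-- Modules induced from a normal subgroup of finite index preserve injectivity. -/
lemma IsInducedUnit.injective [G.Normal] [Finite (Gt ⧸ G)]
    (hη : IsInducedUnit k G.subtype U W η) (hU : Module.Injective (MonoidAlgebra k ↥G) U) :
    Module.Injective (MonoidAlgebra k Gt) W := by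
  have := Fintype.ofFinite (Gt ⧸ G)
  obtain ⟨p, hp, hpη⟩ := hη.exists_proj
  refine ⟨fun X Y _ _ _ _ f hf g => ?_⟩
  let _ : Module (MonoidAlgebra k ↥G) X := Module.compHom X (MapAlong k G.subtype)
  let _ : Module (MonoidAlgebra k ↥G) Y := Module.compHom Y (MapAlong k G.subtype)
  let f' : X →ₗ[MonoidAlgebra k ↥G] Y := { f with map_smul' := fun a x => f.map_smul _ x }
  let g' : X →ₗ[MonoidAlgebra k ↥G] U :=
    { p.comp (g : X →+ W) with
      map_smul' := fun a x => (congrArg p (g.map_smul _ x)).trans (hp a _) }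
  obtain ⟨h, hh⟩ := hU.out f' hf g'
  obtain ⟨T, hT⟩ := exists_relTrace (G := G) (η.comp (h : Y →+ U))
    (fun a y => (congrArg η (h.map_smul a y)).trans (hη.1 a _))
  refine ⟨T, fun x => ?_⟩
  rw [hT, ← hη.sum_proj hp hpη (g x)]
  refine Finset.sum_congr rfl fun q _ => ?_
  rw [← map_smul f]
  refine congrArg (fun u => _ • η u) ((hh _).trans ?_)
  exact congrArg p (g.map_smul _ x)

section Map

variable {U' W' : Type} [AddCommGroup U'] [Module (MonoidAlgebra k ↥G) U']
  [AddCommGroup W'] [Module (MonoidAlgebra k Gt) W'] {η' : U' →+ W'}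
  {j : U →ₗ[MonoidAlgebra k ↥G] U'} {F : W →ₗ[MonoidAlgebra k Gt] W'}

lemma IsInducedUnit.map_injective [G.Normal] [Finite (Gt ⧸ G)]
    (hη : IsInducedUnit k G.subtype U W η) (hη' : IsInducedUnit k G.subtype U' W' η')
    (hF : ∀ u, F (η u) = η' (j u)) (hj : Function.Injective j) : Function.Injective F := by
  have := Fintype.ofFinite (Gt ⧸ G)
  obtain ⟨p, hp, hpη⟩ := hη.exists_proj
  obtain ⟨p', hp', hpη'⟩ := hη'.exists_proj
  have hpF : ∀ w, p' (F w) = j (p w) := fun w => by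
    rw [← hη.sum_proj hp hpη w]
    simp only [map_sum, map_smul, hF, hpη, hpη']
  refine fun v w hvw => hη.eq_of_proj_eq hp hpη fun x => hj ?_
  rw [← hpF, ← hpF, map_smul F, map_smul F, hvw]

lemma IsInducedUnit.map_essential [G.Normal] [Finite (Gt ⧸ G)]
    (hη' : IsInducedUnit k G.subtype U' W' η') (hF : ∀ u, F (η u) = η' (j u))
    (hj : ∀ L : Submodule (MonoidAlgebra k ↥G) U', L ≠ ⊥ → L ⊓ LinearMap.range j ≠ ⊥)
    (L : Submodule (MonoidAlgebra k Gt) W') (hL : L ≠ ⊥) : L ⊓ LinearMap.range F ≠ ⊥ := by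
  classical
  have := Fintype.ofFinite (Gt ⧸ G)
  obtain ⟨p, hp, hpη⟩ := hη'.exists_proj
  have key : ∀ S : Finset (Gt ⧸ G), ∃ w ∈ L, w ≠ 0 ∧
      ∀ q ∈ S, p (MonoidAlgebra.of k Gt q.out⁻¹ • w) ∈ LinearMap.range j := by
    intro S
    induction S using Finset.induction_on with
    | empty =>
      obtain ⟨w, hw, hw0⟩ := L.ne_bot_iff.1 hL
      exact ⟨w, hw, hw0, by simp⟩
    | insert t S _ ih =>
      obtain ⟨w, hw, hw0, hS⟩ := ih
      by_cases ht : p (MonoidAlgebra.of k Gt t.out⁻¹ • w) ∈ LinearMap.range j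
      · exact ⟨w, hw, hw0, Finset.forall_mem_insert _ _ _ |>.2 ⟨ht, hS⟩⟩
      set i := p (MonoidAlgebra.of k Gt t.out⁻¹ • w) with hi
      have hi0 : i ≠ 0 := fun h => ht (h ▸ zero_mem _)
      obtain ⟨u, ⟨hu, huj⟩, hu0⟩ := (Submodule.ne_bot_iff _).1 <|
        hj (Submodule.span _ {i}) (by simpa using hi0)
      obtain ⟨a, rfl⟩ := Submodule.mem_span_singleton.1 hu
      let b : MonoidAlgebra k ↥G := MapAlong k (conjHom Gt G t.out⁻¹) a
      have hb : MonoidAlgebra.of k Gt t.out⁻¹ * MapAlong k G.subtype b =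
          MapAlong k G.subtype a * MonoidAlgebra.of k Gt t.out⁻¹ := (mapAlong_mul_of _ a).symm
      have ht' : p (MonoidAlgebra.of k Gt t.out⁻¹ • MapAlong k G.subtype b • w) = a • i := by
        rw [smul_smul, hb, mul_smul, hp]
      refine ⟨MapAlong k G.subtype b • w, L.smul_mem _ hw, fun h => hu0 ?_,
        Finset.forall_mem_insert _ _ _ |>.2 ⟨ht' ▸ huj, fun q hq => ?_⟩⟩
      · rw [← ht', h, smul_zero, map_zero]
      · rw [smul_smul, of_inv_mul_mapAlong, mul_smul, hp]
        exact Submodule.smul_mem _ _ (hS q hq)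
  obtain ⟨w, hw, hw0, hS⟩ := key Finset.univ
  refine (Submodule.ne_bot_iff _).2 ⟨w, ⟨hw, ?_⟩, hw0⟩
  rw [← hη'.sum_proj hp hpη w]
  refine Submodule.sum_mem _ fun q hq => Submodule.smul_mem _ _ ?_
  obtain ⟨u, hu⟩ := hS q hq
  exact ⟨η u, by rw [hF, hu]⟩

/-- Induction is right exact. -/
lemma IsInducedUnit.coker (hη : IsInducedUnit k G.subtype U W η)
    (hη' : IsInducedUnit k G.subtype U' W' η') (hF : ∀ u, F (η u) = η' (j u)) :
    IsInducedAlong k G.subtype (U' ⧸ LinearMap.range j) (W' ⧸ LinearMap.range F) := by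
  let e : U' ⧸ LinearMap.range j →+ W' ⧸ LinearMap.range F :=
    QuotientAddGroup.lift (LinearMap.range j).toAddSubgroup
      ((LinearMap.range F).mkQ.toAddMonoidHom.comp η') (by
        rintro _ ⟨u, rfl⟩
        change (LinearMap.range F).mkQ (η' (j u)) = 0
        rw [← hF]
        simp)
  have he : ∀ u, e (Submodule.Quotient.mk u) = (LinearMap.range F).mkQ (η' u) := fun _ => rfl
  refine ⟨e, fun a u => ?_, fun X g hg => ?_⟩
  · induction u using Submodule.Quotient.induction_on with | _ u
    rw [← Submodule.Quotient.mk_smul, he, he, hη'.1, map_smul]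
  · obtain ⟨H, hH⟩ := hη'.exists_lift (N := X)
      (g.comp (LinearMap.range j).mkQ.toAddMonoidHom) (fun a u => hg a (Submodule.Quotient.mk u))
    have hHF : H ∘ₗ F = 0 := hη.hom_ext fun u => by
      rw [LinearMap.comp_apply, hF, hH]
      refine (congrArg g ((Submodule.Quotient.mk_eq_zero _).2 ?_)).trans (map_zero g)
      exact LinearMap.mem_range_self j u
    refine ⟨(LinearMap.range F).liftQ H (LinearMap.range_le_ker_iff.2 hHF), fun u => ?_,
      fun H' hH' => ?_⟩
    · induction u using Submodule.Quotient.induction_on with | _ u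
      exact hH u
    · refine Submodule.linearMap_qext _ (hη'.hom_ext fun u => ?_)
      exact (hH' (Submodule.Quotient.mk u)).trans (hH u).symm

end Map

end Induction

/-- With `H²(G̃/G, kˣ) = 1` and `k[G̃/G]` basic, the induction of an
injective envelope of an indecomposable `G̃`-stable module `V` is an injective
envelope of `Ind_G^{G̃} V`, with cokernel the induced module of the cosyzygy. -/
theorem statement_10 (k : Type) [Field k] [IsAlgClosed k]
    (Gt : Type) [Group Gt] [Finite Gt] (G : Subgroup Gt) [G.Normal]
    (hH2 : H2Trivial k (Gt ⧸ G))
    (hbasic : BasicAlg k (MonoidAlgebra k (Gt ⧸ G)))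
    (V : Type) [AddCommGroup V] [Module (MonoidAlgebra k ↥G) V]
    [Module.Finite (MonoidAlgebra k ↥G) V]
    (hindec : IndecMod (MonoidAlgebra k ↥G) V)
    (hstab : IsGtStable k Gt G V)
    (I : Type) [AddCommGroup I] [Module (MonoidAlgebra k ↥G) I]
    (ι : V →ₗ[MonoidAlgebra k ↥G] I) (hι : IsInjEnv (MonoidAlgebra k ↥G) ι)
    (WV WI : Type) [AddCommGroup WV] [Module (MonoidAlgebra k Gt) WV]
    [AddCommGroup WI] [Module (MonoidAlgebra k Gt) WI]
    (ηV : V →+ WV) (hηV : IsInducedUnit k G.subtype V WV ηV)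
    (ηI : I →+ WI) (hηI : IsInducedUnit k G.subtype I WI ηI)
    (F : WV →ₗ[MonoidAlgebra k Gt] WI) (hF : ∀ v : V, F (ηV v) = ηI (ι v)) :
    IsInjEnv (MonoidAlgebra k Gt) F ∧
    IsInducedAlong k G.subtype (I ⧸ LinearMap.range ι) (WI ⧸ LinearMap.range F) := by
  exact ⟨⟨hηI.injective hι.1, hηV.map_injective hηI hF hι.2.1, hηI.map_essential hF hι.2.2⟩,
    hηV.coker hηI hF⟩

end Paper
end

section
/- Let k be an algebraically closed field of characteristic p > 0, G̃ a finite group and G a normal subgroup of G̃ such that H²(G̃/G, k^×) is trivial and the group algebra k[G̃/G] is basic. Let b be a G̃-stable block idempotent of kG (a primitive idempotent of the center of kG with xbx⁻¹ = b for all x ∈ G̃), and assume every simple kG-module lying in the block B = kG·b is G̃-stable. Then the number of isomorphism classes of simple kG̃-modules S with b·S ≠ 0 equals e · m, where e is the number of isomorphism classes of simple k[G̃/G]-modules and m is the number of isomorphism classes of simple kG-modules lying in B. -/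
open scoped TensorProduct

namespace Paper

/-! ### Extending a stable homomorphism from a normal subgroup -/

/-- A homomorphism `ρ` from a normal subgroup `G` of `H` whose conjugates under `H` are all
conjugate in `Γ`, and whose image has centralizer the central subgroup `kˣ`, extends to `H` as soon
as `H²(H/G, kˣ)` is trivial. -/
theorem H2Trivial.exists_extension {k : Type} [Field k] {H Γ : Type} [Group H] [Group Γ]
    {G : Subgroup H} [G.Normal] (hH2 : H2Trivial k (H ⧸ G)) (Z : kˣ →* Γ)
    (hZ : Function.Injective Z) (hZc : ∀ c γ, Commute (Z c) γ) (ρ : ↥G →* Γ)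
    (hcent : ∀ γ, (∀ g, Commute γ (ρ g)) → ∃ c, γ = Z c)
    (hψ : ∀ x : H, ∃ ψ : Γ, ∀ g : ↥G, ψ * ρ (conjHom H G x g) = ρ g * ψ) :
    ∃ σ : H →* Γ, ∀ g : ↥G, σ g = ρ g := by
  choose ψ hψ using hψ
  let t : H ⧸ G → H := Quotient.out
  have ht : ∀ q : H ⧸ G, (QuotientGroup.mk (t q) : H ⧸ G) = q := fun q => Quotient.out_eq _
  let d : H → ↥G := fun x => ⟨(t x)⁻¹ * x, QuotientGroup.eq.1 (ht x)⟩
  let r : H → Γ := fun x => ψ (t x) * ρ (d x)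
  have hmk : ∀ (x : H) (g : ↥G), ((x * g : H) : H ⧸ G) = x := fun x g =>
    (QuotientGroup.eq.2 (by simp)).symm
  have hr1 : ∀ (x : H) (g : ↥G), r (x * g) = r x * ρ g := by
    intro x g
    have h : d (x * g) = d x * g := by
      apply Subtype.ext
      simp only [d, hmk, Subgroup.coe_mul, mul_assoc]
    simp only [r, h, hmk, map_mul, mul_assoc]
  have hr2 : ∀ (x : H) (g : ↥G), r x * ρ (conjHom H G x g) = ρ g * r x := by
    intro x g
    have h : d x * conjHom H G x g = conjHom H G (t x) g * d x := by
      apply Subtype.ext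
      simp only [d, conjHom, Subgroup.coe_mul, MonoidHom.coe_mk, OneHom.coe_mk]
      group
    simp only [r]
    rw [mul_assoc, ← map_mul, h, map_mul, ← mul_assoc, hψ, mul_assoc]
  clear_value r
  have hα : ∀ x y : H, ∃ c : kˣ, r x * r y = Z c * r (x * y) := by
    intro x y
    obtain ⟨c, hc⟩ := hcent (r x * r y * (r (x * y))⁻¹) (by
      intro g
      have h2 : conjHom H G (x * y) g = conjHom H G y (conjHom H G x g) := by
        apply Subtype.ext
        simp only [conjHom, MonoidHom.coe_mk, OneHom.coe_mk]
        group
      have h1 : (r (x * y))⁻¹ * ρ g = ρ (conjHom H G (x * y) g) * (r (x * y))⁻¹ := by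
        rw [inv_mul_eq_iff_eq_mul, ← mul_assoc, hr2, mul_assoc, mul_inv_cancel, mul_one]
      change _ * _ = _ * _
      rw [mul_assoc, h1, h2, mul_assoc (r x), ← mul_assoc (r y), hr2, ← mul_assoc,
        ← mul_assoc, hr2]
      simp only [mul_assoc])
    exact ⟨c, by rw [← hc]; group⟩
  choose α hα using fun q s : H ⧸ G => hα (t q) (t s)
  have hα' : ∀ x y : H, r x * r y = Z (α x y) * r (x * y) := by
    intro x y
    have hx : x = t x * d x := by simp [d]
    have hy : y = t y * d y := by simp [d]
    have hxy : x * y = t x * t y * ↑(conjHom H G (t y) (d x) * d y) := by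
      simp only [d, conjHom, Subgroup.coe_mul, MonoidHom.coe_mk, OneHom.coe_mk]
      group
    have e1 : r x = r (t x) * ρ (d x) := by rw [← hr1, ← hx]
    have e2 : r y = r (t y) * ρ (d y) := by rw [← hr1, ← hy]
    rw [hxy, hr1, ← mul_assoc, ← hα, e1, e2, map_mul, mul_assoc, ← mul_assoc (ρ (d x)), ← hr2]
    simp only [mul_assoc]
  obtain ⟨β, hβ⟩ := hH2 α (by
    intro a b c
    induction a using QuotientGroup.induction_on with | _ a
    induction b using QuotientGroup.induction_on with | _ b
    induction c using QuotientGroup.induction_on with | _ c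
    apply hZ
    have h : r a * r b * r c = r a * (r b * r c) := mul_assoc _ _ _
    rw [hα', mul_assoc, hα', hα', ← mul_assoc (r a), ← (hZc _ (r a)).eq, mul_assoc _ (r a), hα',
      ← mul_assoc, ← mul_assoc, mul_assoc a b c] at h
    rw [map_mul, map_mul]
    exact mul_right_cancel h)
  let σ : H →* Γ := MonoidHom.mk' (fun x => Z (β x)⁻¹ * r x) (by
    intro x y
    have h : Z (β x)⁻¹ * r x * (Z (β y)⁻¹ * r y) = Z ((β x)⁻¹ * (β y)⁻¹) * (r x * r y) := by
      rw [map_mul, mul_assoc, ← mul_assoc (r x), ← (hZc _ (r x)).eq]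
      simp only [mul_assoc]
    rw [h, hα', hβ, ← mul_assoc, ← map_mul, QuotientGroup.mk_mul]
    congr 2
    rw [← mul_assoc, mul_mul_mul_comm, inv_mul_cancel, inv_mul_cancel, one_mul, one_mul])
  refine ⟨σ, fun g => ?_⟩
  have h1 : (QuotientGroup.mk (g : H) : H ⧸ G) = QuotientGroup.mk (1 : H) := by
    simpa only [one_mul] using hmk 1 g
  have h2 : σ g = σ 1 * ρ g := by
    change Z (β (QuotientGroup.mk (g : H)))⁻¹ * r g = Z (β (QuotientGroup.mk (1 : H)))⁻¹ * r 1 * ρ g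
    rw [mul_assoc, ← hr1, one_mul, h1]
  rw [h2, map_one, one_mul]

/-! ### Modules over group algebras -/

section BModule

variable {k : Type} [Field k] {A B : Type} [Group A] [Group B]

/-- The module over the group algebra given by a representation. -/
noncomputable def BModule.ofRep {V : Type} [AddCommGroup V] [Module k V]
    (σ : Representation k A V) : BModule k (MonoidAlgebra k A) :=
  letI : Module (MonoidAlgebra k A) V := Module.compHom V (MonoidAlgebra.lift k _ A σ).toRingHom
  { carrier := V
    isTower := ⟨fun c a v => by
      change MonoidAlgebra.lift k _ A σ (c • a) v = c • MonoidAlgebra.lift k _ A σ a v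
      rw [map_smul, LinearMap.smul_apply]⟩ }

/-- The space of a representation, viewed as a module over the group algebra. -/
noncomputable def BModule.ofRepEquiv {V : Type} [AddCommGroup V] [Module k V]
    (σ : Representation k A V) : V ≃ₗ[k] ↥(BModule.ofRep σ) :=
  LinearEquiv.refl k V

theorem BModule.of_smul_ofRepEquiv {V : Type} [AddCommGroup V] [Module k V]
    (σ : Representation k A V) (a : A) (v : V) :
    MonoidAlgebra.of k A a • BModule.ofRepEquiv σ v = BModule.ofRepEquiv σ (σ a v) := by
  change MonoidAlgebra.lift k _ A σ (MonoidAlgebra.of k A a) v = σ a v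
  rw [MonoidAlgebra.lift_of]

/-- The representation afforded by a module over the group algebra. -/
noncomputable def BModule.rep (V : BModule k (MonoidAlgebra k A)) : Representation k A ↥V :=
  ((Algebra.lsmul k k ↥V : MonoidAlgebra k A →ₐ[k] Module.End k ↥V) : _ →* _).comp
    (MonoidAlgebra.of k A)

@[simp]
theorem BModule.rep_apply (V : BModule k (MonoidAlgebra k A)) (a : A) (v : ↥V) :
    V.rep a v = MonoidAlgebra.of k A a • v :=
  rfl

theorem MapAlong_of (f : A →* B) (a : A) :
    MapAlong k f (MonoidAlgebra.of k A a) = MonoidAlgebra.of k B (f a) := by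
  simp [MapAlong]

theorem MapAlong_smul (f : A →* B) (c : k) (a : MonoidAlgebra k A) :
    MapAlong k f (c • a) = c • MapAlong k f a := by
  induction a using MonoidAlgebra.induction_on with
  | of a => simp [MapAlong]
  | add x y hx hy => rw [smul_add, map_add, map_add, smul_add, hx, hy]
  | smul d x _ => simp [MapAlong, MonoidAlgebra.mapDomain_smul]

theorem map_smul_of_map_of_smul_s11 (f : A →* B) {U W : Type} [AddCommGroup U] [Module k U]
    [Module (MonoidAlgebra k A) U] [IsScalarTower k (MonoidAlgebra k A) U] [AddCommGroup W]
    [Module k W] [Module (MonoidAlgebra k B) W] [IsScalarTower k (MonoidAlgebra k B) W]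
    (φ : U →ₗ[k] W)
    (h : ∀ (a : A) (u : U), φ (MonoidAlgebra.of k A a • u) = MonoidAlgebra.of k B (f a) • φ u)
    (a : MonoidAlgebra k A) (u : U) : φ (a • u) = MapAlong k f a • φ u := by
  induction a using MonoidAlgebra.induction_on with
  | of a => rw [h, MapAlong_of]
  | add x y hx hy => rw [add_smul, map_add, hx, hy, map_add, add_smul]
  | smul c x hx => rw [smul_assoc, map_smul, hx, MapAlong_smul, smul_assoc]

/-- A `k`-linear map commuting with the group elements is linear over the group algebra. -/
def linearMapOfCommutes {U W : Type} [AddCommGroup U] [Module k U]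
    [Module (MonoidAlgebra k A) U] [IsScalarTower k (MonoidAlgebra k A) U] [AddCommGroup W]
    [Module k W] [Module (MonoidAlgebra k A) W] [IsScalarTower k (MonoidAlgebra k A) W]
    (φ : U →ₗ[k] W)
    (h : ∀ (a : A) (u : U), φ (MonoidAlgebra.of k A a • u) = MonoidAlgebra.of k A a • φ u) :
    U →ₗ[MonoidAlgebra k A] W where
  toFun := φ
  map_add' := map_add φ
  map_smul' a u := by
    have := map_smul_of_map_of_smul_s11 (MonoidHom.id A) φ h a u
    rwa [show MapAlong k (MonoidHom.id A) a = a by simp [MapAlong]] at this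

theorem isSimpleModule_of_extends (f : A →* B) {U W : Type} [AddCommGroup U]
    [Module (MonoidAlgebra k A) U] [AddCommGroup W] [Module (MonoidAlgebra k B) W]
    (h : ExtendsAlong k f U W) [hU : IsSimpleModule (MonoidAlgebra k A) U] :
    IsSimpleModule (MonoidAlgebra k B) W := by
  obtain ⟨φ, hφ⟩ := h
  have : Nontrivial U := IsSimpleModule.nontrivial (MonoidAlgebra k A) U
  have : Nontrivial W := φ.symm.toEquiv.nontrivial
  refine { eq_bot_or_eq_top := fun P => ?_ }
  let P' : Submodule (MonoidAlgebra k A) U :=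
    { carrier := {u | φ u ∈ P}
      add_mem' := fun {u v} hu hv => by
        change φ (u + v) ∈ P
        rw [map_add]
        exact P.add_mem hu hv
      zero_mem' := by
        change φ 0 ∈ P
        rw [map_zero]
        exact P.zero_mem
      smul_mem' := fun a u hu => by
        change φ (a • u) ∈ P
        rw [hφ]
        exact P.smul_mem _ hu }
  have hP' : ∀ w, w ∈ P ↔ φ.symm w ∈ P' := fun w => by
    change _ ↔ φ (φ.symm w) ∈ P
    rw [φ.apply_symm_apply]
  rcases eq_bot_or_eq_top P' with h | h
  · left
    ext w
    rw [hP', h, Submodule.mem_bot, Submodule.mem_bot, map_eq_zero_iff _ φ.symm.injective]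
  · right
    ext w
    simp [hP', h]

theorem finite_of_isSimpleModule [Finite A] {U : Type} [AddCommGroup U] [Module k U]
    [Module (MonoidAlgebra k A) U] [IsScalarTower k (MonoidAlgebra k A) U]
    [IsSimpleModule (MonoidAlgebra k A) U] : Module.Finite k U :=
  have : Module.Finite k (MonoidAlgebra k A) := inferInstance
  Module.Finite.trans (MonoidAlgebra k A) U

theorem exists_isSimpleModule_submodule {R : Type} [Ring R] [Algebra k R] {U : Type}
    [AddCommGroup U] [Module k U] [Module R U] [IsScalarTower k R U] [Module.Finite k U]
    [Nontrivial U] : ∃ P : Submodule R U, IsSimpleModule R ↥P := by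
  have : IsArtinian R U := isArtinian_of_tower k inferInstance
  obtain ⟨P, hP⟩ := IsAtomic.exists_atom (Submodule R U)
  exact ⟨P, isSimpleModule_iff_isAtom.2 hP⟩

/-- Schur's lemma for group algebras. -/
theorem exists_eq_smul_of_commutes [IsAlgClosed k] [Finite A] {U : Type} [AddCommGroup U]
    [Module k U] [Module (MonoidAlgebra k A) U] [IsScalarTower k (MonoidAlgebra k A) U]
    [IsSimpleModule (MonoidAlgebra k A) U] (φ : U →ₗ[k] U)
    (h : ∀ (a : A) (u : U), φ (MonoidAlgebra.of k A a • u) = MonoidAlgebra.of k A a • φ u) :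
    ∃ c : k, ∀ u, φ u = c • u := by
  have : Module.Finite k U := finite_of_isSimpleModule (A := A)
  obtain ⟨c, hc⟩ := (IsSimpleModule.algebraMap_end_bijective_of_isAlgClosed
    (A := MonoidAlgebra k A) (V := U) k).2 (linearMapOfCommutes φ h)
  refine ⟨c, fun u => ?_⟩
  have := congrArg (fun F => F u) hc
  exact this.symm

/-- A stable simple module extends, provided the relevant second cohomology is trivial. -/
theorem exists_rep_extending [IsAlgClosed k] [Finite A] (G : Subgroup A) [G.Normal]
    (hH2 : H2Trivial k (A ⧸ G)) (S : BModule k (MonoidAlgebra k ↥G))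
    [IsSimpleModule (MonoidAlgebra k ↥G) ↥S] (hS : IsGtStable k A G ↥S) :
    ∃ σ : Representation k A ↥S,
      ∀ (g : ↥G) (s : ↥S), σ g s = MonoidAlgebra.of k ↥G g • s := by
  have hnt : Nontrivial ↥S := IsSimpleModule.nontrivial (MonoidAlgebra k ↥G) ↥S
  obtain ⟨s₀, hs₀⟩ := exists_ne (0 : ↥S)
  let Z : kˣ →* (Module.End k ↥S)ˣ := Units.map (algebraMap k (Module.End k ↥S) : k →* _)
  have hρ : ∀ (g : ↥G) (s : ↥S),
      (S.rep.toHomUnits g : Module.End k ↥S) s = MonoidAlgebra.of k ↥G g • s := fun _ _ => rfl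
  obtain ⟨σ, hσ⟩ := hH2.exists_extension Z
    (fun c d h => by
      have := congrArg (fun u : (Module.End k ↥S)ˣ => (u : Module.End k ↥S) s₀) h
      exact Units.ext (smul_left_injective k hs₀ this))
    (fun c γ => Units.ext (Algebra.commutes (c : k) (γ : Module.End k ↥S)))
    S.rep.toHomUnits
    (fun γ hγ => by
      obtain ⟨c, hc⟩ := exists_eq_smul_of_commutes (A := ↥G) (γ : Module.End k ↥S)
        (fun g u => congrArg (fun δ : (Module.End k ↥S)ˣ => (δ : Module.End k ↥S) u) (hγ g).eq)
      have hc0 : c ≠ 0 := by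
        rintro rfl
        have h1 : ((γ⁻¹ : (Module.End k ↥S)ˣ) : Module.End k ↥S) ((γ : Module.End k ↥S) s₀) = s₀ :=
          congrArg (fun F : Module.End k ↥S => F s₀) γ.inv_mul
        rw [hc, zero_smul, map_zero] at h1
        exact hs₀ h1.symm
      exact ⟨Units.mk0 c hc0, Units.ext (LinearMap.ext hc)⟩)
    (fun x => by
      obtain ⟨ψ, hψ⟩ := hS x
      have hlin : ∀ (c : k) (u : ↥S), ψ (c • u) = c • ψ u := fun c u => by
        have := hψ (c • 1) u
        rwa [MapAlong_smul, map_one, smul_assoc, smul_assoc, one_smul, one_smul] at this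
      let Ψ : ↥S ≃ₗ[k] ↥S := { ψ with map_smul' := hlin }
      refine ⟨LinearMap.GeneralLinearGroup.generalLinearEquiv k ↥S |>.symm Ψ, fun g => ?_⟩
      refine Units.ext (LinearMap.ext fun u => ?_)
      have := hψ (MonoidAlgebra.of k ↥G g) u
      rw [MapAlong_of] at this
      exact this)
  refine ⟨(Units.coeHom _).comp σ, fun g s => ?_⟩
  rw [MonoidHom.comp_apply, hσ]
  exact hρ g s

/-- A one-dimensional module over a group algebra is given by a linear character. -/
theorem OneDimOver.exists_character {V : BModule k (MonoidAlgebra k A)} (hV : OneDimOver k ↥V) :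
    ∃ χ : A →* k, ∀ (a : A) (v : ↥V), MonoidAlgebra.of k A a • v = χ a • v := by
  obtain ⟨v, hv, hw⟩ := hV
  choose χ hχ using fun a : A => hw (MonoidAlgebra.of k A a • v)
  have h : ∀ (a : A) (w : ↥V), MonoidAlgebra.of k A a • w = χ a • w := by
    intro a w
    obtain ⟨c, rfl⟩ := hw w
    rw [smul_algebra_smul_comm, hχ, smul_comm]
  refine ⟨⟨⟨χ, smul_left_injective k hv ?_⟩, fun a b => smul_left_injective k hv ?_⟩, h⟩
  · change χ 1 • v = (1 : k) • v
    rw [← h, map_one, one_smul, one_smul]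
  · change χ (a * b) • v = (χ a * χ b) • v
    rw [← h, map_mul, mul_smul, h b, smul_algebra_smul_comm, h, smul_smul, mul_comm]

theorem OneDimOver.nonempty_linearEquiv {V W : BModule k (MonoidAlgebra k A)}
    (hV : OneDimOver k ↥V) (hW : OneDimOver k ↥W) (χ : A →* k)
    (hχV : ∀ (a : A) (v : ↥V), MonoidAlgebra.of k A a • v = χ a • v)
    (hχW : ∀ (a : A) (w : ↥W), MonoidAlgebra.of k A a • w = χ a • w) :
    Nonempty (↥V ≃ₗ[MonoidAlgebra k A] ↥W) := by
  have aux : ∀ {U : BModule k (MonoidAlgebra k A)}, OneDimOver k ↥U → Module.finrank k ↥U = 1 := by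
    rintro U ⟨v, hv, h⟩
    exact finrank_eq_one v hv fun w => (h w).imp fun _ h => h.symm
  have : Module.Finite k ↥V := Module.finite_of_finrank_eq_succ (aux hV)
  have : Module.Finite k ↥W := Module.finite_of_finrank_eq_succ (aux hW)
  let e : ↥V ≃ₗ[k] ↥W := LinearEquiv.ofFinrankEq _ _ ((aux hV).trans (aux hW).symm)
  exact ⟨LinearEquiv.ofBijective (linearMapOfCommutes (e : ↥V →ₗ[k] ↥W)
    fun a v => by rw [hχV, hχW, map_smul]) e.bijective⟩

/-- The twist of a representation by a linear character. -/
def twistRep {V : Type} [AddCommGroup V] [Module k V] (σ : Representation k A V) (χ : A →* k) :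
    Representation k A V where
  toFun a := χ a • σ a
  map_one' := by simp
  map_mul' a b := by rw [map_mul, map_mul, smul_mul_smul_comm]

theorem BModule.exists_equiv_of_ofRep_equiv {V W : Type} [AddCommGroup V] [Module k V]
    [AddCommGroup W] [Module k W] {σ : Representation k A V} {τ : Representation k A W}
    (Φ : ↥(BModule.ofRep σ) ≃ₗ[MonoidAlgebra k A] ↥(BModule.ofRep τ)) :
    ∃ F : V ≃ₗ[k] W, ∀ (a : A) (v : V), F (σ a v) = τ a (F v) := by
  refine ⟨(BModule.ofRepEquiv σ).trans
    ((Φ.restrictScalars k).trans (BModule.ofRepEquiv τ).symm), fun a v => ?_⟩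
  simp only [LinearEquiv.trans_apply, LinearEquiv.restrictScalars_apply]
  rw [← BModule.of_smul_ofRepEquiv, map_smul, LinearEquiv.symm_apply_eq,
    ← BModule.of_smul_ofRepEquiv, LinearEquiv.apply_symm_apply]

section Clifford

variable {G : Subgroup A} [G.Normal] {S : BModule k (MonoidAlgebra k ↥G)}
  {σ : Representation k A ↥S}

theorem twist_apply_coe (hσ : ∀ (g : ↥G) (s : ↥S), σ g s = MonoidAlgebra.of k ↥G g • s)
    (χ : A ⧸ G →* k) (g : ↥G) (s : ↥S) :
    twistRep σ (χ.comp (QuotientGroup.mk' G)) g s = MonoidAlgebra.of k ↥G g • s := by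
  have h : QuotientGroup.mk' G (g : A) = 1 := (QuotientGroup.eq_one_iff _).2 g.2
  change χ (QuotientGroup.mk' G (g : A)) • σ g s = _
  rw [h, map_one, one_smul, hσ]

theorem extendsAlong_twist (hσ : ∀ (g : ↥G) (s : ↥S), σ g s = MonoidAlgebra.of k ↥G g • s)
    (χ : A ⧸ G →* k) :
    ExtendsAlong k G.subtype ↥S
      ↥(BModule.ofRep (twistRep σ (χ.comp (QuotientGroup.mk' G)))) := by
  let ε := BModule.ofRepEquiv (twistRep σ (χ.comp (QuotientGroup.mk' G)))
  have hε := map_smul_of_map_of_smul_s11 G.subtype ε.toLinearMap fun g s => by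
    rw [LinearEquiv.coe_coe, Subgroup.subtype_apply, BModule.of_smul_ofRepEquiv,
      twist_apply_coe hσ]
  exact ⟨ε.toAddEquiv, hε⟩

theorem equiv_of_twist_equiv {S' : BModule k (MonoidAlgebra k ↥G)} {σ' : Representation k A ↥S'}
    (hσ : ∀ (g : ↥G) (s : ↥S), σ g s = MonoidAlgebra.of k ↥G g • s)
    (hσ' : ∀ (g : ↥G) (s : ↥S'), σ' g s = MonoidAlgebra.of k ↥G g • s) (χ χ' : A ⧸ G →* k)
    (Φ : ↥(BModule.ofRep (twistRep σ (χ.comp (QuotientGroup.mk' G))))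
      ≃ₗ[MonoidAlgebra k A]
      ↥(BModule.ofRep (twistRep σ' (χ'.comp (QuotientGroup.mk' G))))) :
    Nonempty (↥S ≃ₗ[MonoidAlgebra k ↥G] ↥S') := by
  obtain ⟨F, hF⟩ := BModule.exists_equiv_of_ofRep_equiv Φ
  exact ⟨LinearEquiv.ofBijective (linearMapOfCommutes (F : ↥S →ₗ[k] ↥S') fun g s => by
    rw [← twist_apply_coe hσ χ, LinearEquiv.coe_coe, hF, twist_apply_coe hσ']) F.bijective⟩

theorem character_eq_of_twist_equiv [IsAlgClosed k] [Finite A]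
    [IsSimpleModule (MonoidAlgebra k ↥G) ↥S]
    (hσ : ∀ (g : ↥G) (s : ↥S), σ g s = MonoidAlgebra.of k ↥G g • s) (χ χ' : A ⧸ G →* k)
    (Φ : ↥(BModule.ofRep (twistRep σ (χ.comp (QuotientGroup.mk' G))))
      ≃ₗ[MonoidAlgebra k A]
      ↥(BModule.ofRep (twistRep σ (χ'.comp (QuotientGroup.mk' G))))) :
    χ = χ' := by
  have hnt : Nontrivial ↥S := IsSimpleModule.nontrivial (MonoidAlgebra k ↥G) ↥S
  obtain ⟨s, hs⟩ := exists_ne (0 : ↥S)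
  obtain ⟨F, hF⟩ := BModule.exists_equiv_of_ofRep_equiv Φ
  obtain ⟨c, hc⟩ := exists_eq_smul_of_commutes (A := ↥G) (F : ↥S →ₗ[k] ↥S) fun g s => by
    rw [← twist_apply_coe hσ χ, LinearEquiv.coe_coe, hF, twist_apply_coe hσ]
  ext x
  have hx : F (σ x s) ≠ 0 := by
    rw [Ne, map_eq_zero_iff F F.injective]
    intro h
    exact hs (by rw [← σ.inv_self_apply x s, h, map_zero])
  have h : F (χ x • σ x s) = χ' x • σ x (F s) := hF x s
  rw [map_smul, show F s = c • s from hc s, map_smul, ← show F (σ x s) = c • σ x s from hc _] at h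
  exact smul_left_injective k hx h

/-- A simple module `W` whose restriction receives a nonzero map from `S` is a twist of a given
extension of `S` by a character occurring in a simple submodule of the `G`-invariants of
`Hom(S, W)`. -/
theorem exists_isSimpleModule_equiv_twist [Finite A] [IsSimpleModule (MonoidAlgebra k ↥G) ↥S]
    (hσ : ∀ (g : ↥G) (s : ↥S), σ g s = MonoidAlgebra.of k ↥G g • s)
    (W : BModule k (MonoidAlgebra k A)) [IsSimpleModule (MonoidAlgebra k A) ↥W]
    (f : ↥S →ₗ[k] ↥W) (hf0 : f ≠ 0) (hf : ∀ (g : ↥G) (s : ↥S),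
      f (MonoidAlgebra.of k ↥G g • s) = MonoidAlgebra.of k A g • f s) :
    ∃ V : BModule k (MonoidAlgebra k (A ⧸ G)), IsSimpleModule (MonoidAlgebra k (A ⧸ G)) ↥V ∧
      ∀ χ : A ⧸ G →* k,
        (∀ (q : A ⧸ G) (v : ↥V), MonoidAlgebra.of k (A ⧸ G) q • v = χ q • v) →
        Nonempty (↥W ≃ₗ[MonoidAlgebra k A]
          ↥(BModule.ofRep (twistRep σ (χ.comp (QuotientGroup.mk' G))))) := by
  have : Module.Finite k ↥S := finite_of_isSimpleModule (A := ↥G)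
  have : Module.Finite k ↥W := finite_of_isSimpleModule (A := A)
  let ρ : Representation k A (↥S →ₗ[k] ↥W) := Representation.linHom σ W.rep
  let τ := Representation.quotientToInvariants ρ G
  let N : BModule k (MonoidAlgebra k (A ⧸ G)) := BModule.ofRep τ
  have hfin : Module.Finite k ↥N := Module.Finite.equiv (BModule.ofRepEquiv τ)
  have hfmem : f ∈ Representation.invariants (ρ.comp G.subtype) := by
    intro g
    ext s
    change MonoidAlgebra.of k A (g : A) • f (σ (g : A)⁻¹ s) = f s
    rw [← hf, ← hσ, σ.self_inv_apply]
  have hnt : Nontrivial ↥N := by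
    refine nontrivial_of_ne (BModule.ofRepEquiv τ ⟨f, hfmem⟩) 0 fun h => hf0 ?_
    rw [map_eq_zero_iff _ (BModule.ofRepEquiv τ).injective] at h
    exact congrArg Subtype.val h
  obtain ⟨P, hP⟩ := exists_isSimpleModule_submodule (k := k) (R := MonoidAlgebra k (A ⧸ G))
    (U := ↥N)
  refine ⟨⟨↥P⟩, hP, fun χ hχ => ?_⟩
  have hPnt : Nontrivial ↥P := IsSimpleModule.nontrivial (MonoidAlgebra k (A ⧸ G)) ↥P
  obtain ⟨v, hv⟩ := exists_ne (0 : ↥P)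
  obtain ⟨⟨F, hFmem⟩, hF⟩ := (BModule.ofRepEquiv τ).surjective v.1
  have hF0 : F ≠ 0 := by
    rintro rfl
    apply hv
    apply Subtype.ext
    rw [← hF]
    exact map_zero (BModule.ofRepEquiv τ)
  have hFχ : ∀ (x : A) (s : ↥S),
      MonoidAlgebra.of k A x • F s = χ x • F (σ x s) := by
    intro x s
    have h1 : MonoidAlgebra.of k (A ⧸ G) (x : A ⧸ G) • v.1 = χ x • v.1 :=
      congrArg Subtype.val (hχ x v)
    rw [← hF, BModule.of_smul_ofRepEquiv, ← map_smul] at h1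
    have h2 := congrArg Subtype.val ((BModule.ofRepEquiv τ).injective h1)
    have h3 : MonoidAlgebra.of k A x • F (σ x⁻¹ (σ x s)) = χ x • F (σ x s) :=
      congrArg (fun E : ↥S →ₗ[k] ↥W => E (σ x s)) h2
    rwa [σ.inv_self_apply] at h3
  let T := BModule.ofRep (twistRep σ (χ.comp (QuotientGroup.mk' G)))
  have hT : IsSimpleModule (MonoidAlgebra k A) ↥T :=
    isSimpleModule_of_extends G.subtype (extendsAlong_twist hσ χ)
  let Ψ : ↥T →ₗ[MonoidAlgebra k A] ↥W := linearMapOfCommutes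
    (F ∘ₗ ((BModule.ofRepEquiv (twistRep σ (χ.comp (QuotientGroup.mk' G)))).symm :
      ↥T →ₗ[k] ↥S)) (fun a t => by
      obtain ⟨s, rfl⟩ := (BModule.ofRepEquiv
        (twistRep σ (χ.comp (QuotientGroup.mk' G)))).surjective t
      rw [BModule.of_smul_ofRepEquiv]
      simp only [LinearMap.comp_apply, LinearEquiv.coe_coe, LinearEquiv.symm_apply_apply]
      rw [hFχ, ← map_smul]
      rfl)
  have hΨ : Ψ ≠ 0 := by
    intro h
    apply hF0
    ext s
    exact congrArg (fun E => E (BModule.ofRepEquiv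
      (twistRep σ (χ.comp (QuotientGroup.mk' G))) s)) h
  exact ⟨(LinearEquiv.ofBijective Ψ (LinearMap.bijective_of_ne_zero hΨ)).symm⟩

end Clifford

/-- The restriction of a nonzero module to `G` has a simple submodule, which lies in the block of
`b` if `b` acts as the identity. -/
theorem exists_simple_map_of_liesIn [Finite A] {G : Subgroup A} (b : MonoidAlgebra k ↥G)
    (W : BModule k (MonoidAlgebra k A)) [IsSimpleModule (MonoidAlgebra k A) ↥W]
    (hW : ∀ w : ↥W, MapAlong k G.subtype b • w = w) :
    ∃ U : BModule k (MonoidAlgebra k ↥G), IsSimpleModule (MonoidAlgebra k ↥G) ↥U ∧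
      LiesIn (MonoidAlgebra k ↥G) b ↥U ∧
      ∃ f : ↥U →ₗ[k] ↥W, Function.Injective f ∧ ∀ (g : ↥G) (u : ↥U),
        f (MonoidAlgebra.of k ↥G g • u) = MonoidAlgebra.of k A g • f u := by
  have : Nontrivial ↥W := IsSimpleModule.nontrivial (MonoidAlgebra k A) ↥W
  have : Module.Finite k ↥W := finite_of_isSimpleModule (A := A)
  let σ : Representation k ↥G ↥W := W.rep.comp G.subtype
  have : Nontrivial ↥(BModule.ofRep σ) := (BModule.ofRepEquiv σ).symm.toEquiv.nontrivial
  have : Module.Finite k ↥(BModule.ofRep σ) := Module.Finite.equiv (BModule.ofRepEquiv σ)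
  obtain ⟨P, hP⟩ := exists_isSimpleModule_submodule (k := k) (R := MonoidAlgebra k ↥G)
    (U := ↥(BModule.ofRep σ))
  let f : ↥P →ₗ[k] ↥W := ((BModule.ofRepEquiv σ).symm : _ →ₗ[k] ↥W) ∘ₗ
    (P.subtype.restrictScalars k)
  have hf : Function.Injective f := (BModule.ofRepEquiv σ).symm.injective.comp P.injective_subtype
  have hfG : ∀ (g : ↥G) (u : ↥P),
      f (MonoidAlgebra.of k ↥G g • u) = MonoidAlgebra.of k A (G.subtype g) • f u := by
    intro g u
    change (BModule.ofRepEquiv σ).symm (MonoidAlgebra.of k ↥G g • (u : ↥(BModule.ofRep σ))) = _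
    obtain ⟨w, hw⟩ := (BModule.ofRepEquiv σ).surjective u
    have hfu : f u = w := by
      change (BModule.ofRepEquiv σ).symm (u : ↥(BModule.ofRep σ)) = w
      rw [← hw, LinearEquiv.symm_apply_apply]
    rw [hfu, ← hw, BModule.of_smul_ofRepEquiv, LinearEquiv.symm_apply_apply]
    rfl
  refine ⟨⟨↥P⟩, hP, fun u => hf ?_, f, hf, hfG⟩
  exact (map_smul_of_map_of_smul_s11 G.subtype f hfG b u).trans (hW _)

end BModule



/-- For a `G̃`-stable block idempotent `b` of `kG` with all simple
modules in its block `G̃`-stable, and `H²(G̃/G, kˣ) = 1`, `k[G̃/G]` basic, the number of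
isomorphism classes of simple `k[G̃]`-modules not killed by `b` equals `e · m`. -/
theorem statement_11 (k : Type) [Field k] [IsAlgClosed k]
    (p : ℕ) [Fact p.Prime] [CharP k p]
    (Gt : Type) [Group Gt] [Finite Gt] (G : Subgroup Gt) [G.Normal]
    (hH2 : H2Trivial k (Gt ⧸ G))
    (hbasic : BasicAlg k (MonoidAlgebra k (Gt ⧸ G)))
    (b : MonoidAlgebra k ↥G) (hb : IsBlockIdem (MonoidAlgebra k ↥G) b)
    (hstable : ∀ x : Gt, Commute (MonoidAlgebra.of k Gt x) (MapAlong k G.subtype b))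
    (hsimplestable : ∀ S : BModule k (MonoidAlgebra k ↥G),
        IsSimpleModule (MonoidAlgebra k ↥G) ↥S → LiesIn (MonoidAlgebra k ↥G) b ↥S →
        IsGtStable k Gt G ↥S)
    (e m : ℕ)
    (he : RepClasses k (MonoidAlgebra k (Gt ⧸ G))
        (fun V => IsSimpleModule (MonoidAlgebra k (Gt ⧸ G)) ↥V) e)
    (hm : RepClasses k (MonoidAlgebra k ↥G)
        (fun S => IsSimpleModule (MonoidAlgebra k ↥G) ↥S ∧
          LiesIn (MonoidAlgebra k ↥G) b ↥S) m) :
    RepClasses k (MonoidAlgebra k Gt)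
      (fun S => IsSimpleModule (MonoidAlgebra k Gt) ↥S ∧
        ∃ s : ↥S, MapAlong k G.subtype b • s ≠ 0) (e * m) := by
  obtain ⟨V, hV, hVinj, hVsurj⟩ := he
  obtain ⟨S, hS, hSinj, hSsurj⟩ := hm
  have hSsimple := fun i => (hS i).1
  choose χ hχ using fun j => (hbasic (V j) (hV j)).exists_character
  choose σ hσ using fun i => exists_rep_extending G hH2 (S i)
    (hsimplestable (S i) (hS i).1 (hS i).2)
  let T : Fin e → Fin m → BModule k (MonoidAlgebra k Gt) := fun j i =>
    BModule.ofRep (twistRep (σ i) ((χ j).comp (QuotientGroup.mk' G)))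
  have hT : ∀ j i, IsSimpleModule (MonoidAlgebra k Gt) ↥(T j i) ∧
      ∃ s : ↥(T j i), MapAlong k G.subtype b • s ≠ 0 := by
    intro j i
    have hext := extendsAlong_twist (hσ i) (χ j)
    refine ⟨isSimpleModule_of_extends G.subtype hext, ?_⟩
    obtain ⟨φ, hφ⟩ := hext
    have hnt : Nontrivial ↥(S i) := IsSimpleModule.nontrivial (MonoidAlgebra k ↥G) ↥(S i)
    obtain ⟨s, hs⟩ := exists_ne (0 : ↥(S i))
    refine ⟨φ s, ?_⟩
    rw [← hφ, (hS i).2, Ne, map_eq_zero_iff φ φ.injective]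
    exact hs
  have hTinj : ∀ j i j' i', (↥(T j i) ≃ₗ[MonoidAlgebra k Gt] ↥(T j' i')) → (j, i) = (j', i') := by
    intro j i j' i' Φ
    obtain rfl : i = i' := by
      by_contra h
      exact (hSinj i i' h).false (equiv_of_twist_equiv (hσ i) (hσ i') _ _ Φ).some
    have h := character_eq_of_twist_equiv (hσ i) _ _ Φ
    obtain rfl : j = j' := by
      by_contra hj
      exact (hVinj j j' hj).false (OneDimOver.nonempty_linearEquiv (hbasic _ (hV j))
        (hbasic _ (hV j')) (χ j) (hχ j) (h ▸ hχ j')).some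
    rfl
  refine ⟨fun n => T (finProdFinEquiv.symm n).1 (finProdFinEquiv.symm n).2, fun n => hT _ _,
    fun n n' hn => ⟨fun Φ => hn (finProdFinEquiv.symm.injective (hTinj _ _ _ _ Φ))⟩, ?_⟩
  · rintro W ⟨hW, w₀, hw₀⟩
    have hcomm : ∀ a, a * MapAlong k G.subtype b = MapAlong k G.subtype b * a := by
      intro a
      induction a using MonoidAlgebra.induction_on with
      | of x => exact hstable x
      | add x y hx hy => rw [add_mul, mul_add, hx, hy]
      | smul c x hx => rw [smul_mul_assoc, mul_smul_comm, hx]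
    have htop : blockComp (MonoidAlgebra k Gt) (MapAlong k G.subtype b) hcomm ↥W = ⊤ := by
      refine (eq_bot_or_eq_top _).resolve_left fun h => hw₀ ?_
      rw [← Submodule.mem_bot (MonoidAlgebra k Gt), ← h]
      change MapAlong k G.subtype b • MapAlong k G.subtype b • w₀ = MapAlong k G.subtype b • w₀
      rw [smul_smul, ← map_mul, hb.2.1.1]
    have hbW : ∀ w : ↥W, MapAlong k G.subtype b • w = w := fun w =>
      show w ∈ blockComp (MonoidAlgebra k Gt) (MapAlong k G.subtype b) hcomm ↥W from
        htop ▸ Submodule.mem_top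
    obtain ⟨U, hU, hUb, f, hf, hfG⟩ := exists_simple_map_of_liesIn b W hbW
    obtain ⟨i, ⟨ε⟩⟩ := hSsurj U ⟨hU, hUb⟩
    have hnt : Nontrivial ↥(S i) := IsSimpleModule.nontrivial (MonoidAlgebra k ↥G) ↥(S i)
    obtain ⟨s, hs⟩ := exists_ne (0 : ↥(S i))
    obtain ⟨V', hV', hV'W⟩ := exists_isSimpleModule_equiv_twist (hσ i) W
      (f ∘ₗ ((ε.symm.restrictScalars k : ↥(S i) ≃ₗ[k] ↥U) : ↥(S i) →ₗ[k] ↥U))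
      (fun h => by
        have h' : f (ε.symm s) = 0 := congrArg (fun F => F s) h
        rw [map_eq_zero_iff f hf, map_eq_zero_iff ε.symm ε.symm.injective] at h'
        exact hs h')
      (fun g s => by
        change f (ε.symm _) = _
        rw [map_smul, hfG]
        rfl)
    obtain ⟨j, ⟨δ⟩⟩ := hVsurj V' hV'
    have hχ' : ∀ (q : Gt ⧸ G) (v : ↥V'),
        MonoidAlgebra.of k (Gt ⧸ G) q • v = χ j q • v := fun q v => δ.injective (by
      rw [map_smul, hχ, ← δ.restrictScalars_apply k (χ j q • v), map_smul,
        δ.restrictScalars_apply k v])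
    obtain ⟨n, hn⟩ := finProdFinEquiv.symm.surjective (j, i)
    obtain rfl : (finProdFinEquiv.symm n).1 = j := by rw [hn]
    obtain rfl : (finProdFinEquiv.symm n).2 = i := by rw [hn]
    exact ⟨n, hV'W _ hχ'⟩

end Paper
end
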